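/- Let n ≥ 1 and let θ = Id_{2n+1} |◇ α_{2n+1} be the left pasting of the identity permutation of {1,…,2n+1} with the Stefan orbit α_{2n+1}. Then θ is a simple permutation of mixed order 4n+2; concretely: (i) θ maps the set {1,…,2n+1} onto the set {2n+2,…,4n+2} and maps {2n+2,…,4n+2} onto {1,…,2n+1}; (ii) θ² = α_{2n+1} ◇| α_{2n+1}; (iii) the order of θ is 4n+2. -/

import Mathlib

/-- Left pasting `α |◇ β`: the permutation of `{1,…,m+n}` with
`(α |◇ β)(i) = α(i) + n` for `1 ≤ i ≤ m` and `(α |◇ β)(m+i) = β(i)` for `1 ≤ i ≤ n`. -/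
def pasteLeft {m n : ℕ} (α : Equiv.Perm (Fin m)) (β : Equiv.Perm (Fin n)) :
    Equiv.Perm (Fin (m + n)) :=
  finSumFinEquiv.symm.trans ((Equiv.sumCongr α β).trans
    ((Equiv.sumComm (Fin m) (Fin n)).trans (finSumFinEquiv.trans (finCongr (Nat.add_comm n m)))))

/-- Right pasting `α ◇| β`: the permutation of `{1,…,m+n}` with
`(α ◇| β)(i) = α(i)` for `1 ≤ i ≤ m` and `(α ◇| β)(m+i) = β(i) + m` for `1 ≤ i ≤ n`. -/
def pasteRight {m n : ℕ} (α : Equiv.Perm (Fin m)) (β : Equiv.Perm (Fin n)) :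
    Equiv.Perm (Fin (m + n)) :=
  finSumFinEquiv.symm.trans ((Equiv.sumCongr α β).trans finSumFinEquiv)

/-- Transport a permutation of `Fin ((2n+1)+(2n+1))` to one of `Fin (4n+2)`. -/
def toPerm42 (n : ℕ) (σ : Equiv.Perm (Fin (2 * n + 1 + (2 * n + 1)))) :
    Equiv.Perm (Fin (4 * n + 2)) :=
  (finCongr (by omega : 2 * n + 1 + (2 * n + 1) = 4 * n + 2)).permCongr σ

/-- Embedding of `Fin (2n+1)` as the lower half. -/
def embLo (n : ℕ) (i : Fin (2 * n + 1)) : Fin (4 * n + 2) := ⟨i, by omega⟩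

/-- Embedding of `Fin (2n+1)` as the upper half. -/
def embHi (n : ℕ) (i : Fin (2 * n + 1)) : Fin (4 * n + 2) := ⟨2 * n + 1 + i, by omega⟩

/-- `θ = Id_{2n+1} |◇ α_{2n+1}` is a simple permutation of mixed order `4n+2`:
(i) `θ` maps `{1,…,2n+1}` onto `{2n+2,…,4n+2}` and vice versa;
(ii) `θ² = α_{2n+1} ◇| α_{2n+1}`; (iii) `orderOf θ = 4n+2`.
The Stefan orbit `α = α_{2n+1}` is characterized 1-indexed by the hypotheses
(`i : Fin (2*n+1)` represents the point `(i : ℕ) + 1`). -/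
theorem pasteLeft_id_alpha_is_simple (n : ℕ) (hn : 1 ≤ n)
    (α : Equiv.Perm (Fin (2 * n + 1)))
    (hα1 : ∀ i : Fin (2 * n + 1), 1 ≤ (i : ℕ) + 1 → (i : ℕ) + 1 ≤ n →
      (α i : ℕ) + 1 = 2 * n + 2 - ((i : ℕ) + 1))
    (hα2 : ∀ i : Fin (2 * n + 1), n + 1 ≤ (i : ℕ) + 1 → (i : ℕ) + 1 ≤ 2 * n →
      (α i : ℕ) + 1 = 2 * n + 1 - ((i : ℕ) + 1))
    (hα3 : ∀ i : Fin (2 * n + 1), (i : ℕ) + 1 = 2 * n + 1 → (α i : ℕ) + 1 = n + 1)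
    (θ : Equiv.Perm (Fin (4 * n + 2)))
    (hθ : θ = toPerm42 n (pasteLeft (1 : Equiv.Perm (Fin (2 * n + 1))) α)) :
    ⇑θ '' {x : Fin (4 * n + 2) | (x : ℕ) < 2 * n + 1} =
        {x : Fin (4 * n + 2) | 2 * n + 1 ≤ (x : ℕ)} ∧
    ⇑θ '' {x : Fin (4 * n + 2) | 2 * n + 1 ≤ (x : ℕ)} =
        {x : Fin (4 * n + 2) | (x : ℕ) < 2 * n + 1} ∧
    θ ^ 2 = toPerm42 n (pasteRight α α) ∧
    orderOf θ = 4 * n + 2 := by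
  have he : ∀ i, θ (embLo n i) = embHi n i := by
    intro i; subst hθ
    have : (finCongr (by omega : 2 * n + 1 + (2 * n + 1) = 4 * n + 2)).symm (embLo n i)
        = Fin.castAdd (2 * n + 1) i := by ext; simp [embLo]
    rw [toPerm42, Equiv.permCongr_apply, this]
    ext; simp [pasteLeft, embHi]; try omega
  have hf : ∀ i, θ (embHi n i) = embLo n (α i) := by
    intro i; subst hθ
    have : (finCongr (by omega : 2 * n + 1 + (2 * n + 1) = 4 * n + 2)).symm (embHi n i)
        = Fin.natAdd (2 * n + 1) i := by ext; rfl
    rw [toPerm42, Equiv.permCongr_apply, this]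
    ext; simp [pasteLeft, embLo, -Fin.natAdd_eq_addNat]
  have hre : ∀ i, toPerm42 n (pasteRight α α) (embLo n i) = embLo n (α i) := by
    intro i
    have : (finCongr (by omega : 2 * n + 1 + (2 * n + 1) = 4 * n + 2)).symm (embLo n i)
        = Fin.castAdd (2 * n + 1) i := by ext; simp [embLo]
    rw [toPerm42, Equiv.permCongr_apply, this]
    ext; simp [pasteRight, embLo]
  have hrf : ∀ i, toPerm42 n (pasteRight α α) (embHi n i) = embHi n (α i) := by
    intro i
    have : (finCongr (by omega : 2 * n + 1 + (2 * n + 1) = 4 * n + 2)).symm (embHi n i)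
        = Fin.natAdd (2 * n + 1) i := by ext; rfl
    rw [toPerm42, Equiv.permCongr_apply, this]
    ext; simp [pasteRight, embHi, -Fin.natAdd_eq_addNat]
  have hcase : ∀ x : Fin (4 * n + 2), (∃ i, x = embLo n i) ∨ (∃ i, x = embHi n i) := by
    intro x
    by_cases hx : (x : ℕ) < 2 * n + 1
    · exact Or.inl ⟨⟨x, hx⟩, rfl⟩
    · refine Or.inr ⟨⟨x - (2 * n + 1), by omega⟩, ?_⟩
      ext; simp only [embHi]; omega
  have hlo : ∀ i, ((embLo n i : Fin (4 * n + 2)) : ℕ) = i := fun i => rfl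
  have hhi : ∀ i, ((embHi n i : Fin (4 * n + 2)) : ℕ) = 2 * n + 1 + i := fun i => rfl
  have hsq : θ ^ 2 = toPerm42 n (pasteRight α α) := by
    apply Equiv.ext
    intro x
    rw [pow_two, Equiv.Perm.mul_apply]
    rcases hcase x with ⟨i, rfl⟩ | ⟨i, rfl⟩
    · rw [he, hf, hre]
    · rw [hf, he, hrf]
  have hpe : ∀ k i, (θ ^ (2 * k)) (embLo n i) = embLo n ((α ^ k) i) := by
    intro k i
    rw [pow_mul, hsq]
    induction k with
    | zero => rfl
    | succ k ih => rw [pow_succ', pow_succ', Equiv.Perm.mul_apply, ih, hre]; rfl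
  have hpf : ∀ k i, (θ ^ (2 * k)) (embHi n i) = embHi n ((α ^ k) i) := by
    intro k i
    rw [pow_mul, hsq]
    induction k with
    | zero => rfl
    | succ k ih => rw [pow_succ', pow_succ', Equiv.Perm.mul_apply, ih, hrf]; rfl
  have hmid : n < 2 * n + 1 := by omega
  have horb : ∀ k, (k ≤ n → (((α ^ (2 * k)) ⟨n, hmid⟩ : Fin (2 * n + 1)) : ℕ) = n + k) ∧
      (k < n → (((α ^ (2 * k + 1)) ⟨n, hmid⟩ : Fin (2 * n + 1)) : ℕ) = n - 1 - k) := by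
    intro k
    have step : ∀ k, k < n → (((α ^ (2 * k)) ⟨n, hmid⟩ : Fin (2 * n + 1)) : ℕ) = n + k →
        (((α ^ (2 * k + 1)) ⟨n, hmid⟩ : Fin (2 * n + 1)) : ℕ) = n - 1 - k := by
      intro k hk h
      rw [pow_succ', Equiv.Perm.mul_apply]
      have := hα2 ((α ^ (2 * k)) ⟨n, hmid⟩) (by omega) (by omega)
      omega
    induction k with
    | zero => exact ⟨fun _ => rfl, fun h => step 0 h rfl⟩
    | succ k ih =>
      have h1 : k + 1 ≤ n →
          (((α ^ (2 * (k + 1))) ⟨n, hmid⟩ : Fin (2 * n + 1)) : ℕ) = n + (k + 1) := by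
        intro hk
        have h := ih.2 (by omega)
        rw [show 2 * (k + 1) = (2 * k + 1) + 1 by ring, pow_succ', Equiv.Perm.mul_apply]
        have := hα1 ((α ^ (2 * k + 1)) ⟨n, hmid⟩) (by omega) (by omega)
        omega
      exact ⟨h1, fun hk => step (k + 1) hk (h1 (by omega))⟩
  have hper : (α ^ (2 * n + 1)) ⟨n, hmid⟩ = ⟨n, hmid⟩ := by
    ext
    have h := (horb n).1 le_rfl
    rw [pow_succ', Equiv.Perm.mul_apply]
    have := hα3 ((α ^ (2 * n)) ⟨n, hmid⟩) (by omega)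
    simp only
    omega
  have hreach : ∀ p : Fin (2 * n + 1), ∃ j, (α ^ j) ⟨n, hmid⟩ = p := by
    intro p
    by_cases hp : n ≤ (p : ℕ)
    · refine ⟨2 * (p - n), ?_⟩
      ext
      rw [(horb _).1 (by omega)]; omega
    · refine ⟨2 * (n - 1 - p) + 1, ?_⟩
      ext
      rw [(horb _).2 (by omega)]; omega
  have hone : α ^ (2 * n + 1) = 1 := by
    apply Equiv.ext
    intro p
    obtain ⟨j, rfl⟩ := hreach p
    rw [← Equiv.Perm.mul_apply, ← pow_add, add_comm _ j, pow_add, Equiv.Perm.mul_apply, hper]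
    rfl
  refine ⟨?_, ?_, hsq, ?_⟩
  · ext x
    simp only [Set.mem_image, Set.mem_ofPred_eq]
    constructor
    · rintro ⟨y, hy, rfl⟩
      rcases hcase y with ⟨i, rfl⟩ | ⟨i, rfl⟩
      · rw [he, hhi]; omega
      · rw [hhi] at hy; omega
    · intro hx
      rcases hcase x with ⟨i, rfl⟩ | ⟨i, rfl⟩
      · rw [hlo] at hx; omega
      · exact ⟨embLo n i, by rw [hlo]; omega, he i⟩
  · ext x
    simp only [Set.mem_image, Set.mem_ofPred_eq]
    constructor
    · rintro ⟨y, hy, rfl⟩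
      rcases hcase y with ⟨i, rfl⟩ | ⟨i, rfl⟩
      · rw [hlo] at hy; omega
      · rw [hf, hlo]; omega
    · intro hx
      rcases hcase x with ⟨i, rfl⟩ | ⟨i, rfl⟩
      · exact ⟨embHi n (α.symm i), by rw [hhi]; omega, by rw [hf, Equiv.apply_symm_apply]⟩
      · rw [hhi] at hx; omega
  · rw [orderOf_eq_iff (by omega)]
    constructor
    · apply Equiv.ext
      intro x
      have hx : θ ^ (4 * n + 2) = θ ^ (2 * (2 * n + 1)) := congrArg (θ ^ ·) (by ring)
      rw [hx]
      rcases hcase x with ⟨i, rfl⟩ | ⟨i, rfl⟩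
      · rw [hpe, hone]; rfl
      · rw [hpf, hone]; rfl
    · intro m hm hm0 h1
      have h2 : (((θ ^ m) (embLo n ⟨n, hmid⟩) : Fin (4 * n + 2)) : ℕ) = n := by rw [h1]; rfl
      rcases Nat.even_or_odd' m with ⟨j, rfl | rfl⟩
      · rw [hpe, hlo] at h2
        rcases Nat.even_or_odd' j with ⟨k, rfl | rfl⟩
        · rw [(horb k).1 (by omega)] at h2; omega
        · rw [(horb k).2 (by omega)] at h2; omega
      · rw [pow_succ', Equiv.Perm.mul_apply, hpe, he, hhi] at h2
        omega
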